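/- Let d ≥ 1 and let f : ℝ^d → ℝ have L_G-Lipschitz gradient and L_H-Lipschitz Hessian, with L_G, L_H > 0. Let x, g, h ∈ ℝ^d and let H be a symmetric d×d real matrix such that h satisfies the cubic-model optimality conditions for (g, H, L_H). Then for every δ > 0: max(‖∇f(x)‖, (−(2/L_H)·λ_min(∇²f(x)))³) ≤ L_G·δ + 2L_H·δ² + 4δ³ + ‖∇f(x) − g‖ + ‖∇²f(x) − H‖_op²/(4L_H) + (32/L_H³)·‖H − ∇²f(x)‖_op³ + (36/L_H)·(L_G/δ² + 2L_H/δ + 4)·( f(x) − f(x + h) + (4/√(3L_H))·‖∇f(x) − g‖^{3/2} + (24/L_H²)·‖∇²f(x) − H‖_op³ ). -/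

import Mathlib

open scoped RealInnerProductSpace

/-- The spectral (operator) norm of a square real matrix. -/
noncomputable def matOpNorm {d : ℕ} (A : Matrix (Fin d) (Fin d) ℝ) : ℝ :=
  ‖Matrix.toEuclideanCLM (𝕜 := ℝ) A‖

/-- The smallest eigenvalue of a symmetric matrix `A`, as the infimum of `⟪A v, v⟫` over
unit vectors `v`. -/
noncomputable def lambdaMin {d : ℕ} (A : Matrix (Fin d) (Fin d) ℝ) : ℝ :=
  sInf {r : ℝ | ∃ v : EuclideanSpace ℝ (Fin d), ‖v‖ = 1 ∧
    r = ⟪(Matrix.toEuclideanCLM (𝕜 := ℝ) A) v, v⟫}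

/-- The cubic-model optimality conditions for `(g, H, M)` at the step `h`:
(i) `g + H h + (M/2)‖h‖ h = 0`; (ii) `H + (M/2)‖h‖ I ⪰ 0`; (iii) `⟪g, h⟫ ≤ 0`. -/
def CubicOptConditions {d : ℕ} (g : EuclideanSpace ℝ (Fin d))
    (H : Matrix (Fin d) (Fin d) ℝ) (M : ℝ) (h : EuclideanSpace ℝ (Fin d)) : Prop :=
  g + (Matrix.toEuclideanCLM (𝕜 := ℝ) H) h + ((M / 2) * ‖h‖) • h = 0 ∧
  (H + ((M / 2) * ‖h‖) • (1 : Matrix (Fin d) (Fin d) ℝ)).PosSemidef ∧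
  ⟪g, h⟫ ≤ 0

/-- A differentiable function with nonpositive derivative on `[0, ∞)` stays below its initial
value there. -/
theorem le_initial_of_hasDerivAt_nonpos {φ φ' : ℝ → ℝ} (hφ : ∀ t, HasDerivAt φ (φ' t) t)
    (hφ' : ∀ t, 0 ≤ t → φ' t ≤ 0) {t : ℝ} (ht : 0 ≤ t) : φ t ≤ φ 0 := by
  have anti : AntitoneOn φ (Set.Ici 0) := by
    refine antitoneOn_of_deriv_nonpos (convex_Ici 0)
      (fun s _ => (hφ s).continuousAt.continuousWithinAt)
      (fun s _ => (hφ s).differentiableAt.differentiableWithinAt) fun s hs => ?_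
    rw [(hφ s).deriv]
    exact hφ' s (interior_subset hs)
  exact anti Set.self_mem_Ici ht ht

section CubicTaylor

variable {E : Type*} [NormedAddCommGroup E] [InnerProductSpace ℝ E] [CompleteSpace E]

/-- Second-order Taylor upper bound for a function whose gradient has derivative `A` with
`A` Lipschitz. -/
theorem taylor_cubic_upper_bound {f : E → ℝ} (hf : Differentiable ℝ f) {A : E → E →L[ℝ] E}
    (hA : ∀ y, HasFDerivAt (gradient f) (A y) y) {M : ℝ}
    (hLip : ∀ a b, ‖A a - A b‖ ≤ M * ‖a - b‖) (x h : E) :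
    f (x + h) ≤ f x + ⟪gradient f x, h⟫ + ⟪A x h, h⟫ / 2 + M / 6 * ‖h‖ ^ 3 := by
  have hline (t : ℝ) : HasDerivAt (fun s : ℝ => x + s • h) h t := by
    simpa using ((hasDerivAt_id t).smul_const h).const_add x
  have hgrad (t : ℝ) : HasDerivAt (fun s : ℝ => ⟪gradient f (x + s • h), h⟫)
      ⟪A (x + t • h) h, h⟫ t := by
    have key := ((hA (x + t • h)).comp_hasDerivAt t (hline t)).inner ℝ (hasDerivAt_const t h)
    simpa using key
  have hval (t : ℝ) : HasDerivAt (fun s : ℝ => f (x + s • h)) ⟪gradient f (x + t • h), h⟫ t := by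
    have key := (hf (x + t • h)).hasGradientAt.hasFDerivAt.comp_hasDerivAt t (hline t)
    simpa [Function.comp_def] using key
  have first (t : ℝ) (ht : 0 ≤ t) : ⟪gradient f (x + t • h), h⟫ - ⟪gradient f x, h⟫
      - t * ⟪A x h, h⟫ - M * ‖h‖ ^ 3 / 2 * t ^ 2 ≤ 0 := by
    have key := le_initial_of_hasDerivAt_nonpos
      (φ := fun s => ⟪gradient f (x + s • h), h⟫ - ⟪gradient f x, h⟫
        - s * ⟪A x h, h⟫ - M * ‖h‖ ^ 3 / 2 * s ^ 2)
      (fun s => (((hgrad s).sub_const _).sub ((hasDerivAt_id s).mul_const _)).sub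
        (((hasDerivAt_pow 2 s)).const_mul _))
      (fun s hs => ?_) ht
    · simpa using key
    · have hop : ⟪(A (x + s • h) - A x) h, h⟫ ≤ M * (s * ‖h‖) * ‖h‖ * ‖h‖ := by
        refine (real_inner_le_norm _ _).trans ?_
        gcongr
        refine (ContinuousLinearMap.le_opNorm _ _).trans ?_
        gcongr
        simpa [norm_smul, abs_of_nonneg hs] using hLip (x + s • h) x
      rw [sub_apply, inner_sub_left] at hop
      norm_num
      linarith
  have key := le_initial_of_hasDerivAt_nonpos
    (φ := fun s => f (x + s • h) - s * ⟪gradient f x, h⟫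
        - ⟪A x h, h⟫ / 2 * s ^ 2 - M * ‖h‖ ^ 3 / 6 * s ^ 3)
    (fun s => (((hval s).sub ((hasDerivAt_id s).mul_const _)).sub
      ((hasDerivAt_pow 2 s).const_mul _)).sub ((hasDerivAt_pow 3 s).const_mul _))
    (fun s hs => ?_) zero_le_one
  · norm_num [-inner_gradient_left] at key
    linarith
  · have := first s hs
    norm_num [-inner_gradient_left]
    linarith

end CubicTaylor

/-- Young's inequality with exponents `3` and `3 / 2`, scaled so that the cubic term is
`M / 36 * r ^ 3`. -/
theorem mul_le_cubic_add_rpow {M e r : ℝ} (hM : 0 < M) (he : 0 ≤ e) (hr : 0 ≤ r) :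
    e * r ≤ M / 36 * r ^ 3 + 4 / √(3 * M) * e ^ ((3 : ℝ) / 2) := by
  have hs : 0 < √(3 * M) := Real.sqrt_pos.mpr (by positivity)
  have hs2 : √(3 * M) ^ 2 = 3 * M := Real.sq_sqrt (by positivity)
  have hu2 : √e ^ 2 = e := Real.sq_sqrt he
  have hpow : e ^ ((3 : ℝ) / 2) = √e ^ 3 := by
    rw [Real.sqrt_eq_rpow, ← Real.rpow_natCast, ← Real.rpow_mul he]
    norm_num
  rw [hpow]
  have hu := Real.sqrt_nonneg e
  set s := √(3 * M)
  set u := √e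
  have hMs : M = s ^ 2 / 3 := by linarith
  rw [← hu2, hMs, ← sub_nonneg]
  have factor : s ^ 2 / 3 / 36 * r ^ 3 + 4 / s * u ^ 3 - u ^ 2 * r
      = (s * r - 6 * u) ^ 2 * (s * r + 12 * u) / (108 * s) := by
    field_simp
    ring
  rw [factor]
  positivity

/-- Young's inequality with exponents `3 / 2` and `3`, scaled so that the cubic term is
`M / 36 * r ^ 3`. -/
theorem mul_sq_le_cubic_add_cubic {M e r : ℝ} (hM : 0 < M) (he : 0 ≤ e) (hr : 0 ≤ r) :
    e * r ^ 2 / 2 ≤ M / 36 * r ^ 3 + 24 / M ^ 2 * e ^ 3 := by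
  have factor : M / 36 * r ^ 3 + 24 / M ^ 2 * e ^ 3 - e * r ^ 2 / 2
      = (M * r - 12 * e) ^ 2 * (M * r + 6 * e) / (36 * M ^ 2) := by
    field_simp
    ring
  rw [← sub_nonneg, factor]
  positivity

/-- A monomial in `r` of degree one or two is at most its value at `δ` plus a multiple of
`r ^ 3`. -/
theorem linear_add_quadratic_le_cubic {L M δ r : ℝ} (hL : 0 ≤ L) (hM : 0 ≤ M) (hδ : 0 < δ)
    (hr : 0 ≤ r) :
    L * r + 2 * M * r ^ 2 ≤ L * δ + 2 * M * δ ^ 2 + (L / δ ^ 2 + 2 * M / δ) * r ^ 3 := by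
  have h1 : r ≤ δ + r ^ 3 / δ ^ 2 := by
    rcases le_total r δ with hle | hle
    · have : 0 ≤ r ^ 3 / δ ^ 2 := by positivity
      linarith
    · have : r ≤ r ^ 3 / δ ^ 2 := by
        rw [le_div_iff₀ (by positivity)]
        calc r * δ ^ 2 ≤ r * r ^ 2 := by gcongr
          _ = r ^ 3 := by ring
      linarith
  have h2 : r ^ 2 ≤ δ ^ 2 + r ^ 3 / δ := by
    rcases le_total r δ with hle | hle
    · have : r ^ 2 ≤ δ ^ 2 := by gcongr
      have : 0 ≤ r ^ 3 / δ := by positivity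
      linarith
    · have : r ^ 2 ≤ r ^ 3 / δ := by
        rw [le_div_iff₀ (by positivity)]
        calc r ^ 2 * δ ≤ r ^ 2 * r := by gcongr
          _ = r ^ 3 := by ring
      have : 0 ≤ δ ^ 2 := by positivity
      linarith
  calc L * r + 2 * M * r ^ 2 ≤ L * (δ + r ^ 3 / δ ^ 2) + 2 * M * (δ ^ 2 + r ^ 3 / δ) := by gcongr
    _ = _ := by ring

/-- Lower bound on the smallest eigenvalue from a lower bound on the quadratic form. -/
theorem le_lambdaMin {d : ℕ} (hd : 1 ≤ d) {A : Matrix (Fin d) (Fin d) ℝ} {c : ℝ}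
    (hc : ∀ v : EuclideanSpace ℝ (Fin d), ‖v‖ = 1 →
      c ≤ ⟪(Matrix.toEuclideanCLM (𝕜 := ℝ) A) v, v⟫) : c ≤ lambdaMin A := by
  refine le_csInf ⟨_, EuclideanSpace.single ⟨0, hd⟩ 1, by simp, rfl⟩ ?_
  rintro _ ⟨v, hv, rfl⟩
  exact hc v hv

/-- The quadratic form of a shifted positive semidefinite matrix is bounded below. -/
theorem inner_toEuclideanCLM_ge {d : ℕ} {A : Matrix (Fin d) (Fin d) ℝ} {c : ℝ}
    (hA : (A + c • (1 : Matrix (Fin d) (Fin d) ℝ)).PosSemidef) (v : EuclideanSpace ℝ (Fin d)) :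
    -(c * ‖v‖ ^ 2) ≤ ⟪(Matrix.toEuclideanCLM (𝕜 := ℝ) A) v, v⟫ := by
  have key := (Matrix.isPositive_toEuclideanLin_iff.mpr hA).inner_nonneg_left v
  have hsplit : Matrix.toEuclideanLin (A + c • (1 : Matrix (Fin d) (Fin d) ℝ)) v
      = Matrix.toEuclideanCLM (𝕜 := ℝ) A v + c • v := by
    ext i
    simp
  rw [hsplit, inner_add_left, real_inner_smul_left, real_inner_self_eq_norm_sq] at key
  linarith

/-- **Per-round second-order regret bound for the inexact cubic-regularized Newton step.**
Under `L_G`-Lipschitz gradient and `L_H`-Lipschitz Hessian, if `h` satisfies the cubic-model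
optimality conditions for `(g, H, L_H)`, then for every threshold `δ > 0` the second-order
stationarity quantity at `x` is bounded by the stated combination of `δ`, the estimation
errors, and the function decrease `f x − f (x + h)`. -/
theorem cubic_step_second_order_regret_bound
    (d : ℕ) (hd : 1 ≤ d) (L_G L_H : ℝ) (hLG : 0 < L_G) (hLH : 0 < L_H)
    (f : EuclideanSpace ℝ (Fin d) → ℝ) (hf : Differentiable ℝ f)
    (hGradLip : ∀ a b, ‖gradient f a - gradient f b‖ ≤ L_G * ‖a - b‖)
    (Hf : EuclideanSpace ℝ (Fin d) → Matrix (Fin d) (Fin d) ℝ)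
    (hHess : ∀ y, HasFDerivAt (fun z => gradient f z)
      (Matrix.toEuclideanCLM (𝕜 := ℝ) (Hf y)) y)
    (hHsymm : ∀ y, (Hf y).IsHermitian)
    (hHessLip : ∀ a b, matOpNorm (Hf a - Hf b) ≤ L_H * ‖a - b‖)
    (x g h : EuclideanSpace ℝ (Fin d)) (H : Matrix (Fin d) (Fin d) ℝ)
    (hHsym : H.IsHermitian)
    (hopt : CubicOptConditions g H L_H h)
    (δ : ℝ) (hδ : 0 < δ) :
    max ‖gradient f x‖ ((-(2 / L_H) * lambdaMin (Hf x)) ^ 3) ≤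
      L_G * δ + 2 * L_H * δ ^ 2 + 4 * δ ^ 3 + ‖gradient f x - g‖
        + (matOpNorm (Hf x - H)) ^ 2 / (4 * L_H)
        + (32 / L_H ^ 3) * (matOpNorm (H - Hf x)) ^ 3
        + (36 / L_H) * (L_G / δ ^ 2 + 2 * L_H / δ + 4) *
          (f x - f (x + h)
            + (4 / Real.sqrt (3 * L_H)) * ‖gradient f x - g‖ ^ ((3 : ℝ) / 2)
            + (24 / L_H ^ 2) * (matOpNorm (Hf x - H)) ^ 3) := by
  obtain ⟨hstat, hpsd, hgh⟩ := hopt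
  set A := Matrix.toEuclideanCLM (𝕜 := ℝ) (Hf x) with hAdef
  set B := Matrix.toEuclideanCLM (𝕜 := ℝ) H with hBdef
  have hsub : matOpNorm (Hf x - H) = ‖A - B‖ := by
    simp [matOpNorm, hAdef, hBdef, map_sub]
  have hsub' : matOpNorm (H - Hf x) = ‖A - B‖ := by
    rw [norm_sub_rev]
    simp [matOpNorm, hAdef, hBdef, map_sub]
  rw [hsub, hsub']
  have hAnorm : ‖A‖ ≤ L_G :=
    (hHess x).le_of_lip' hLG.le (Filter.Eventually.of_forall fun y => hGradLip y x)
  have hquad (v : EuclideanSpace ℝ (Fin d)) : |⟪A v, v⟫ - ⟪B v, v⟫| ≤ ‖A - B‖ * ‖v‖ ^ 2 := by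
    rw [← inner_sub_left, ← sub_apply]
    calc |⟪(A - B) v, v⟫| ≤ ‖(A - B) v‖ * ‖v‖ := abs_real_inner_le_norm _ _
      _ ≤ ‖A - B‖ * ‖v‖ * ‖v‖ := by gcongr; exact ContinuousLinearMap.le_opNorm _ _
      _ = ‖A - B‖ * ‖v‖ ^ 2 := by ring
  have htaylor := taylor_cubic_upper_bound hf hHess
    (fun a b => by simpa [matOpNorm, map_sub] using hHessLip a b) x h
  rw [← hAdef] at htaylor
  have hinner : ⟪g, h⟫ + ⟪B h, h⟫ + L_H / 2 * ‖h‖ ^ 3 = 0 := by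
    have := congrArg (fun z => ⟪z, h⟫) hstat
    simp only [inner_add_left, real_inner_smul_left, real_inner_self_eq_norm_sq,
      inner_zero_left] at this
    linarith
  have hgerr : ⟪gradient f x, h⟫ - ⟪g, h⟫ ≤ ‖gradient f x - g‖ * ‖h‖ := by
    rw [← inner_sub_left]
    exact real_inner_le_norm _ _
  have hgrad : ‖gradient f x‖ ≤ ‖gradient f x - g‖ + L_G * ‖h‖ + ‖A - B‖ * ‖h‖
      + L_H / 2 * ‖h‖ ^ 2 := by
    have hdecomp : gradient f x
        = (gradient f x - g) - A h + (A - B) h - (L_H / 2 * ‖h‖) • h := by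
      rw [sub_apply, ← sub_eq_zero, ← hstat]
      abel
    have h1 : ‖A h‖ ≤ L_G * ‖h‖ := (A.le_opNorm h).trans (by gcongr)
    have h2 := (A - B).le_opNorm h
    have h3 : ‖(L_H / 2 * ‖h‖) • h‖ = L_H / 2 * ‖h‖ ^ 2 := by
      rw [norm_smul, Real.norm_of_nonneg (by positivity)]
      ring
    have t1 := norm_sub_le ((gradient f x - g) - A h + (A - B) h) ((L_H / 2 * ‖h‖) • h)
    have t2 := norm_add_le ((gradient f x - g) - A h) ((A - B) h)
    have t3 := norm_sub_le (gradient f x - g) (A h)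
    rw [← hdecomp] at t1
    linarith
  have heig : -(‖A - B‖ + L_H / 2 * ‖h‖) ≤ lambdaMin (Hf x) := by
    refine le_lambdaMin hd fun v hv => ?_
    have h1 := inner_toEuclideanCLM_ge hpsd v
    have h2 := (abs_le.mp (hquad v)).1
    rw [hv] at h1 h2
    linarith
  have hqh := (abs_le.mp (hquad h)).2
  have hr : 0 ≤ ‖h‖ := norm_nonneg h
  have he : 0 ≤ ‖A - B‖ := norm_nonneg _
  have hε : 0 ≤ ‖gradient f x - g‖ := norm_nonneg _
  set r := ‖h‖
  set e := ‖A - B‖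
  set ε := ‖gradient f x - g‖
  have hdesc : L_H / 36 * r ^ 3 ≤ f x - f (x + h) + 4 / √(3 * L_H) * ε ^ ((3 : ℝ) / 2)
      + 24 / L_H ^ 2 * e ^ 3 := by
    have h1 := mul_le_cubic_add_rpow hLH hε hr
    have h2 := mul_sq_le_cubic_add_cubic hLH he hr
    linarith
  set D := f x - f (x + h) + 4 / √(3 * L_H) * ε ^ ((3 : ℝ) / 2) + 24 / L_H ^ 2 * e ^ 3
  have hcube : r ^ 3 ≤ 36 / L_H * D := by
    calc r ^ 3 = 36 / L_H * (L_H / 36 * r ^ 3) := by field_simp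
      _ ≤ 36 / L_H * D := by gcongr
  have hmain : (L_G / δ ^ 2 + 2 * L_H / δ + 4) * r ^ 3
      ≤ 36 / L_H * (L_G / δ ^ 2 + 2 * L_H / δ + 4) * D := by
    calc (L_G / δ ^ 2 + 2 * L_H / δ + 4) * r ^ 3
        ≤ (L_G / δ ^ 2 + 2 * L_H / δ + 4) * (36 / L_H * D) := by gcongr
      _ = _ := by ring
  have hE3 : 0 ≤ 32 / L_H ^ 3 * e ^ 3 := by positivity
  have hE2 : 0 ≤ e ^ 2 / (4 * L_H) := by positivity
  have hδ3 : 0 ≤ δ ^ 3 := by positivity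
  have hr3 : 0 ≤ r ^ 3 := by positivity
  refine max_le ?_ ?_
  · have hyoung : e * r ≤ e ^ 2 / (4 * L_H) + L_H * r ^ 2 := by
      have factor : e ^ 2 / (4 * L_H) + L_H * r ^ 2 - e * r
          = (e - 2 * L_H * r) ^ 2 / (4 * L_H) := by
        field_simp
        ring
      rw [← sub_nonneg, factor]
      positivity
    have h1 := linear_add_quadratic_le_cubic hLG.le hLH.le hδ hr
    have h2 : 0 ≤ L_H * r ^ 2 := by positivity
    linarith
  · have hbase : -(2 / L_H) * lambdaMin (Hf x) ≤ 2 * e / L_H + r := by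
      calc -(2 / L_H) * lambdaMin (Hf x) = 2 / L_H * -lambdaMin (Hf x) := by ring
        _ ≤ 2 / L_H * (e + L_H / 2 * r) := by gcongr; linarith
        _ = 2 * e / L_H + r := by field_simp
    have hpow : (-(2 / L_H) * lambdaMin (Hf x)) ^ 3 ≤ (2 * e / L_H + r) ^ 3 :=
      (Odd.strictMono_pow (by decide : Odd 3)).monotone hbase
    have hconv := add_pow_le (show 0 ≤ 2 * e / L_H by positivity) hr 3
    have hexp : (2 : ℝ) ^ (3 - 1) * ((2 * e / L_H) ^ 3 + r ^ 3)
        = 32 / L_H ^ 3 * e ^ 3 + 4 * r ^ 3 := by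
      norm_num
      field_simp
      ring
    have hcoef : 0 ≤ (L_G / δ ^ 2 + 2 * L_H / δ) * r ^ 3 := by positivity
    have hLδ : 0 ≤ L_G * δ + 2 * L_H * δ ^ 2 := by positivity
    linarith
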